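/- In the staged construction of G₁: w.h.p. there exist no sets S, L ⊆ V such that |L| = k−1, S is a minimal L-disconnected set of G₁, and n_s ≤ |S| ≤ 2^{n/5}. -/

import Mathlib

open scoped Classical
open Filter

noncomputable section

/-- The vertex set of the `n`-dimensional hypercube: `{0,1}^n`. -/
abbrev Vtx (n : ℕ) := Fin n → Bool

/-- The `n`-dimensional hypercube graph `Q^n`: two vertices are adjacent iff they
differ in exactly one coordinate. -/
def cubeGraph (n : ℕ) : SimpleGraph (Vtx n) :=
  SimpleGraph.fromRel (fun u v => hammingDist u v = 1)

/-- Sample space for the `k`-out model on `Q^n`: each vertex `v` chooses a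
`k`-element set of its neighbours (equivalently, `k` incident edges). -/
abbrev KOut (n k : ℕ) :=
  ∀ v : Vtx n, {s : Finset (Vtx n) // s.card = k ∧ ∀ u ∈ s, (cubeGraph n).Adj v u}

/-- The random subgraph produced by an outcome of the `k`-out model. -/
def kOutGraph (n k : ℕ) (ω : KOut n k) : SimpleGraph (Vtx n) :=
  SimpleGraph.fromRel (fun u v => v ∈ (ω u).1)

/-- Uniform (counting) probability of an event on a finite sample space. -/
def prob {Ω : Type*} [Finite Ω] (p : Ω → Prop) : ℝ :=
  (Nat.card {ω : Ω // p ω} : ℝ) / (Nat.card Ω : ℝ)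

/-- `S` is `L`-disconnected in `G`: `S` is nonempty, disjoint from `L`, and `G` has
no edge joining `S` to the vertices outside `S ∪ L`. -/
def LDisc {V : Type*} (G : SimpleGraph V) (L S : Finset V) : Prop :=
  S.Nonempty ∧ Disjoint S L ∧ ∀ u ∈ S, ∀ w : V, G.Adj u w → w ∈ S ∨ w ∈ L

/-- `S` is a minimal `L`-disconnected set of `G`: it is `L`-disconnected and no
nonempty proper subset of `S` is `L`-disconnected in `G`. -/
def MinLDisc {V : Type*} (G : SimpleGraph V) (L S : Finset V) : Prop :=
  LDisc G L S ∧ ∀ S' ⊂ S, ¬ LDisc G L S'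

/-- `k₁ = ⌈log₂ n − 2·log₂log₂ n⌉ + 1`, as an integer. -/
def kone (n : ℕ) : ℤ :=
  ⌈Real.logb 2 n - 2 * Real.logb 2 (Real.logb 2 n)⌉ + 1

/-- `n_s = 2^{k₁ − 0.1}`. -/
def nsmall (n : ℕ) : ℝ := (2 : ℝ) ^ ((kone n : ℝ) - 0.1)

/-- The set `A₀` of "active" vertices after generating `G₀` (distributed as
`Q^n(k−1)`): those lying in some minimal `L`-disconnected set of `G₀` of size at
most `n_s`, for some `L` of size `k−1`. -/
def activeSet (n k : ℕ) (ω₀ : KOut n (k - 1)) : Set (Vtx n) :=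
  {v | ∃ L S : Finset (Vtx n), L.card = k - 1 ∧
    MinLDisc (kOutGraph n (k - 1) ω₀) L S ∧ (S.card : ℝ) ≤ nsmall n ∧ v ∈ S}

/-- Sample space for the staged construction of `G₁`: an outcome of the `(k−1)`-out
model `G₀` together with, for every vertex `v`, an extra uniformly random neighbour
not among the `k−1` neighbours already chosen by `v` (only the extra choices of the
vertices of `A₀` are used to build `G₁`). -/
abbrev SpaceG1 (n k : ℕ) :=
  {p : KOut n (k - 1) × (∀ v : Vtx n, {u : Vtx n // (cubeGraph n).Adj v u}) //
    ∀ v : Vtx n, (p.2 v : Vtx n) ∉ (p.1 v : Finset (Vtx n))}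

/-- The graph `G₁`: the edges of `G₀` together with the extra edges `e_k(v)` chosen
by the vertices `v ∈ A₀`. -/
def graphG1 (n k : ℕ) (ω : SpaceG1 n k) : SimpleGraph (Vtx n) :=
  SimpleGraph.fromRel (fun u v =>
    v ∈ (ω.1.1 u : Finset (Vtx n)) ∨
      (u ∈ activeSet n k ω.1.1 ∧ (ω.1.2 u : Vtx n) = v))

/-- The neighbour of `v` in the hypercube along the direction `i`. -/
def flipBit {n : ℕ} (v : Vtx n) (i : Fin n) : Vtx n := Function.update v i (!v i)

lemma flipBit_apply_self {n : ℕ} (v : Vtx n) (i : Fin n) : flipBit v i i = !v i := by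
  simp [flipBit]

lemma flipBit_apply_of_ne {n : ℕ} (v : Vtx n) {i j : Fin n} (h : j ≠ i) :
    flipBit v i j = v j := by
  simp [flipBit, h]

lemma flipBit_flipBit {n : ℕ} (v : Vtx n) (i : Fin n) : flipBit (flipBit v i) i = v := by
  simp [flipBit]

lemma flipBit_injective {n : ℕ} (v : Vtx n) : Function.Injective (flipBit v) := by
  intro i j h
  by_contra hij
  have h1 := congrFun h i
  rw [flipBit_apply_self, flipBit_apply_of_ne v hij] at h1
  simp at h1

lemma cubeGraph_adj_iff {n : ℕ} (u v : Vtx n) :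
    (cubeGraph n).Adj u v ↔ ∃ i, flipBit u i = v := by
  have key : hammingDist u v = 1 ↔ ∃ i, flipBit u i = v := by
    rw [hammingDist, Finset.card_eq_one]
    refine exists_congr fun i => ⟨fun h => ?_, ?_⟩
    · funext j
      have hj := Finset.ext_iff.1 h j
      simp only [Finset.mem_filter, Finset.mem_univ, true_and, Finset.mem_singleton] at hj
      by_cases hji : j = i
      · subst hji
        rw [flipBit_apply_self, Bool.not_eq]
        exact hj.2 rfl
      · rw [flipBit_apply_of_ne u hji]
        by_contra hne
        exact hji (hj.1 hne)
    · rintro rfl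
      ext j
      simp only [Finset.mem_filter, Finset.mem_univ, true_and, Finset.mem_singleton]
      by_cases hji : j = i
      · subst hji
        simp [flipBit_apply_self]
      · simp [flipBit_apply_of_ne u hji, hji]
  rw [cubeGraph, SimpleGraph.fromRel_adj, hammingDist_comm v u, or_self, key]
  refine and_iff_right_of_imp ?_
  rintro ⟨i, rfl⟩ h
  have := congrFun h i
  rw [flipBit_apply_self] at this
  simp at this

/-- The neighbourhood of a vertex of the hypercube. -/
def nbrs {n : ℕ} (v : Vtx n) : Finset (Vtx n) := Finset.univ.image (flipBit v)

lemma mem_nbrs {n : ℕ} {u v : Vtx n} : v ∈ nbrs u ↔ (cubeGraph n).Adj u v := by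
  simp [nbrs, cubeGraph_adj_iff]

lemma card_nbrs {n : ℕ} (v : Vtx n) : (nbrs v).card = n := by
  rw [nbrs, Finset.card_image_of_injective _ (flipBit_injective v), Finset.card_univ,
    Fintype.card_fin]

/-- The vertices visited by the walk from `v` that follows the directions in `w`. -/
def walkSet {n : ℕ} : Vtx n → List (Fin n) → Finset (Vtx n)
  | v, [] => {v}
  | v, i :: w => insert v (walkSet (flipBit v i) w)

lemma start_mem_walkSet {n : ℕ} (v : Vtx n) (w : List (Fin n)) : v ∈ walkSet v w := by
  cases w <;> simp [walkSet]

lemma walkSet_detour {n : ℕ} (v : Vtx n) (i : Fin n) (w : List (Fin n)) :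
    walkSet v (i :: i :: w) = insert (flipBit v i) (walkSet v w) := by
  rw [walkSet, walkSet, flipBit_flipBit, Finset.insert_comm,
    Finset.insert_eq_of_mem (start_mem_walkSet v w)]

lemma exists_walkSet_insert {n : ℕ} (w : List (Fin n)) (v u : Vtx n) (hu : u ∈ walkSet v w)
    (i : Fin n) :
    ∃ w' : List (Fin n), w'.length = w.length + 2 ∧
      walkSet v w' = insert (flipBit u i) (walkSet v w) := by
  induction w generalizing v with
  | nil =>
    obtain rfl : u = v := by simpa [walkSet] using hu
    exact ⟨[i, i], rfl, walkSet_detour u i []⟩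
  | cons j w ih =>
    by_cases huv : u = v
    · subst huv
      exact ⟨i :: i :: j :: w, rfl, walkSet_detour u i (j :: w)⟩
    · have hu' : u ∈ walkSet (flipBit v j) w := by
        simpa [walkSet, huv] using hu
      obtain ⟨w', hl, hw'⟩ := ih (flipBit v j) hu'
      exact ⟨j :: w', by simp [hl], by rw [walkSet, hw', walkSet, Finset.insert_comm]⟩

/-- Every nonempty proper subset of `S` sends an edge of the hypercube to the rest of `S`. -/
def CubeConnected {n : ℕ} (S : Finset (Vtx n)) : Prop :=
  S.Nonempty ∧ ∀ T ⊂ S, T.Nonempty → ∃ u ∈ T, ∃ i, flipBit u i ∈ S \ T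

lemma CubeConnected.exists_walkSet {n : ℕ} {S : Finset (Vtx n)} (hS : CubeConnected S) :
    ∃ v, ∃ w : List (Fin n), w.length = 2 * (S.card - 1) ∧ walkSet v w = S := by
  obtain ⟨⟨v, hv⟩, hconn⟩ := hS
  have grow : ∀ m, m + 1 ≤ S.card → ∃ w : List (Fin n), w.length = 2 * m ∧
      walkSet v w ⊆ S ∧ (walkSet v w).card = m + 1 := by
    intro m
    induction m with
    | zero => exact fun _ => ⟨[], by simp, by simpa [walkSet] using hv, by simp [walkSet]⟩
    | succ m ih =>
      intro hm
      obtain ⟨w, hl, hsub, hcard⟩ := ih (by omega)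
      obtain ⟨u, hu, i, hi⟩ := hconn (walkSet v w)
        ((Finset.ssubset_iff_subset_ne).2 ⟨hsub, fun h => by rw [h] at hcard; omega⟩)
        ⟨v, start_mem_walkSet v w⟩
      rw [Finset.mem_sdiff] at hi
      obtain ⟨w', hl', hw'⟩ := exists_walkSet_insert w v u hu i
      exact ⟨w', by omega, by rw [hw']; exact Finset.insert_subset hi.1 hsub,
        by rw [hw', Finset.card_insert_of_notMem hi.2, hcard]⟩
  have hpos : 0 < S.card := Finset.card_pos.2 ⟨v, hv⟩
  obtain ⟨w, hl, hsub, hcard⟩ := grow (S.card - 1) (by omega)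
  exact ⟨v, w, hl, Finset.eq_of_subset_of_card_le hsub (by omega)⟩

/-- The connected vertex sets of size `s`. -/
def connSets (n s : ℕ) : Finset (Finset (Vtx n)) :=
  Finset.univ.filter fun S => CubeConnected S ∧ S.card = s

lemma card_connSets_le (n s : ℕ) : (connSets n s).card ≤ 2 ^ n * n ^ (2 * (s - 1)) := by
  have hsub : connSets n s ⊆
      (Finset.univ : Finset (Vtx n × List.Vector (Fin n) (2 * (s - 1)))).image
        fun p => walkSet p.1 p.2.1 := by
    intro S hS
    simp only [connSets, Finset.mem_filter, Finset.mem_univ, true_and] at hS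
    obtain ⟨v, w, hl, rfl⟩ := hS.1.exists_walkSet
    rw [hS.2] at hl
    exact Finset.mem_image.2 ⟨(v, ⟨w, hl⟩), Finset.mem_univ _, rfl⟩
  calc (connSets n s).card ≤ _ := Finset.card_le_card hsub
    _ ≤ _ := Finset.card_image_le
    _ = 2 ^ n * n ^ (2 * (s - 1)) := by
      rw [Finset.card_univ, Fintype.card_prod, card_vector]
      simp

lemma log_isoperimetric_merge {a b : ℝ} (ha : 0 < a) (hab : a ≤ b) :
    a * Real.logb 2 a + b * Real.logb 2 b + 2 * a ≤ (a + b) * Real.logb 2 (a + b) := by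
  have hb : 0 < b := ha.trans_le hab
  have h2 : (0 : ℝ) < Real.log 2 := Real.log_pos (by norm_num)
  have h1 : a * Real.log 2 ≤ a * (Real.log (a + b) - Real.log a) := by
    refine mul_le_mul_of_nonneg_left ?_ ha.le
    rw [← Real.log_div (by positivity) ha.ne']
    refine Real.log_le_log (by norm_num) ?_
    rw [le_div_iff₀ ha]
    linarith
  have h3 : a * Real.log 2 ≤ b * (Real.log (a + b) - Real.log b) := by
    have hp : 1 ≤ b / a := (one_le_div ha).2 hab
    have hq : (2 : ℝ) ≤ (1 + a / b) ^ (b / a) := by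
      refine le_trans (le_of_eq ?_)
        (one_add_mul_self_le_rpow_one_add (s := a / b) (by linarith [div_pos ha hb]) hp)
      field_simp
      norm_num
    have := Real.log_le_log (by norm_num) hq
    rw [Real.log_rpow (by positivity)] at this
    have he : 1 + a / b = (a + b) / b := by field_simp; ring
    rw [he, Real.log_div (by positivity) hb.ne'] at this
    calc a * Real.log 2 ≤ a * (b / a * (Real.log (a + b) - Real.log b)) :=
          mul_le_mul_of_nonneg_left this ha.le
      _ = _ := by field_simp
  simp only [Real.logb]
  rw [← sub_nonneg]
  have : (a + b) * (Real.log (a + b) / Real.log 2) -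
      (a * (Real.log a / Real.log 2) + b * (Real.log b / Real.log 2) + 2 * a) =
      (a * (Real.log (a + b) - Real.log a) - a * Real.log 2 +
        (b * (Real.log (a + b) - Real.log b) - a * Real.log 2)) / Real.log 2 := by
    field_simp
    ring
  rw [this]
  exact div_nonneg (by linarith) h2.le

/-- The number of neighbours of `v` in `T`. -/
def degIn {n : ℕ} (T : Finset (Vtx n)) (v : Vtx n) : ℕ := (nbrs v ∩ T).card

lemma degIn_le {n : ℕ} (T : Finset (Vtx n)) (v : Vtx n) : degIn T v ≤ n :=
  (Finset.card_le_card Finset.inter_subset_left).trans (card_nbrs v).le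

/-- The vertices of `T` whose coordinate `i` equals `c`. -/
def halfCube {n : ℕ} (T : Finset (Vtx n)) (i : Fin n) (c : Bool) : Finset (Vtx n) :=
  T.filter fun v => v i = c

lemma sum_degIn_halfCube_le {n : ℕ} (T : Finset (Vtx n)) (i : Fin n) (c : Bool) :
    ∑ v ∈ halfCube T i c, degIn T v ≤
      ∑ v ∈ halfCube T i c, degIn (halfCube T i c) v +
        min (halfCube T i c).card (halfCube T i (!c)).card := by
  have hdeg : ∀ v ∈ halfCube T i c, degIn T v ≤
      degIn (halfCube T i c) v + if flipBit v i ∈ T then 1 else 0 := by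
    intro v hv
    have hvc : v i = c := (Finset.mem_filter.1 hv).2
    have hsub : nbrs v ∩ T ⊆ (nbrs v ∩ halfCube T i c) ∪
        (if flipBit v i ∈ T then {flipBit v i} else ∅) := by
      intro u hu
      obtain ⟨hu1, huT⟩ := Finset.mem_inter.1 hu
      obtain ⟨j, -, rfl⟩ := Finset.mem_image.1 hu1
      by_cases hj : j = i
      · subst hj
        simp [huT]
      · refine Finset.mem_union_left _ (Finset.mem_inter.2 ⟨hu1, Finset.mem_filter.2 ⟨huT, ?_⟩⟩)
        rw [flipBit_apply_of_ne v (Ne.symm hj), hvc]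
    refine (Finset.card_le_card hsub).trans ((Finset.card_union_le _ _).trans ?_)
    refine Nat.add_le_add le_rfl ?_
    split_ifs <;> simp
  refine (Finset.sum_le_sum hdeg).trans ?_
  rw [Finset.sum_add_distrib, ← Finset.card_filter]
  refine Nat.add_le_add le_rfl (le_min (Finset.card_filter_le _ _) ?_)
  refine Finset.card_le_card_of_injOn (fun v => flipBit v i) ?_ ?_
  · intro v hv
    have hv' := Finset.mem_filter.1 (Finset.mem_coe.1 hv)
    have hvc : v i = c := (Finset.mem_filter.1 hv'.1).2
    exact Finset.mem_coe.2 (Finset.mem_filter.2 ⟨hv'.2, (flipBit_apply_self v i).trans (by rw [hvc])⟩)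
  · intro u _ v _ h
    have := congrArg (fun x => flipBit x i) h
    simpa [flipBit_flipBit] using this

/-- The edge-isoperimetric inequality of the hypercube: the degrees inside `T` sum to at most
`|T| log₂ |T|`. -/
theorem sum_degIn_le {n : ℕ} (T : Finset (Vtx n)) :
    ((∑ v ∈ T, degIn T v : ℕ) : ℝ) ≤ T.card * Real.logb 2 T.card := by
  induction T using Finset.strongInduction with
  | H T ih =>
    by_cases hT : T.card ≤ 1
    · rcases Finset.card_le_one_iff_subset_singleton.1 hT with ⟨v, hv⟩
      have hzero : ∀ u ∈ T, degIn T u = 0 := by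
        intro u hu
        obtain rfl := Finset.mem_singleton.1 (hv hu)
        refine Finset.card_eq_zero.2 (Finset.eq_empty_of_forall_notMem fun x hx => ?_)
        obtain ⟨hx1, hxT⟩ := Finset.mem_inter.1 hx
        obtain rfl := Finset.mem_singleton.1 (hv hxT)
        exact (mem_nbrs.1 hx1).ne rfl
      rw [Finset.sum_eq_zero hzero]
      have : T.card = 0 ∨ T.card = 1 := by omega
      rcases this with h | h <;> simp [h]
    · obtain ⟨a, ha, b, hb, hab⟩ := Finset.one_lt_card.1 (not_le.1 hT)
      obtain ⟨i, hi⟩ := Function.ne_iff.1 hab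
      have hne : ∀ c, (halfCube T i c).Nonempty := by
        intro c
        by_cases hc : a i = c
        · exact ⟨a, Finset.mem_filter.2 ⟨ha, hc⟩⟩
        · refine ⟨b, Finset.mem_filter.2 ⟨hb, ?_⟩⟩
          revert hi hc
          cases a i <;> cases b i <;> cases c <;> simp
      have hcard : T.card = (halfCube T i true).card + (halfCube T i false).card := by
        rw [← Finset.card_filter_add_card_filter_not (s := T) (fun v => v i = true)]
        simp [halfCube]
      have hss : ∀ c, halfCube T i c ⊂ T := by
        intro c
        refine Finset.ssubset_iff_subset_ne.2 ⟨Finset.filter_subset _ _, fun h => ?_⟩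
        have h1 := Finset.card_pos.2 (hne true)
        have h2 := Finset.card_pos.2 (hne false)
        cases c <;> rw [h] at hcard <;> omega
      have hsum : ∑ v ∈ T, degIn T v =
          ∑ v ∈ halfCube T i true, degIn T v + ∑ v ∈ halfCube T i false, degIn T v := by
        rw [← Finset.sum_filter_add_sum_filter_not T (fun v => v i = true)]
        simp [halfCube]
      have h1 := sum_degIn_halfCube_le T i true
      have h0 := sum_degIn_halfCube_le T i false
      rw [Bool.not_true] at h1
      rw [Bool.not_false, min_comm] at h0
      have e1 := ih _ (hss true)
      have e0 := ih _ (hss false)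
      have p1 : (0 : ℝ) < (halfCube T i true).card := by exact_mod_cast Finset.card_pos.2 (hne true)
      have p0 : (0 : ℝ) < (halfCube T i false).card := by
        exact_mod_cast Finset.card_pos.2 (hne false)
      have hR : ((∑ v ∈ T, degIn T v : ℕ) : ℝ) ≤
          ((∑ v ∈ halfCube T i true, degIn (halfCube T i true) v : ℕ) : ℝ) +
          ((∑ v ∈ halfCube T i false, degIn (halfCube T i false) v : ℕ) : ℝ) +
          2 * ((min (halfCube T i true).card (halfCube T i false).card : ℕ) : ℝ) := by
        exact_mod_cast (by omega : ∑ v ∈ T, degIn T v ≤ _)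
      refine hR.trans ?_
      rw [hcard, Nat.cast_add]
      rcases le_total (halfCube T i true).card (halfCube T i false).card with hle | hle
      · rw [min_eq_left hle]
        linarith [log_isoperimetric_merge p1 (by exact_mod_cast hle :
          ((halfCube T i true).card : ℝ) ≤ (halfCube T i false).card)]
      · rw [min_eq_right hle]
        have := log_isoperimetric_merge p0 (by exact_mod_cast hle :
          ((halfCube T i false).card : ℝ) ≤ (halfCube T i true).card)
        rw [add_comm ((halfCube T i false).card : ℝ)] at this
        linarith

lemma choose_mul_pow_le {d n : ℕ} (h : d ≤ n) (r : ℕ) :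
    d.choose r * n ^ r ≤ n.choose r * d ^ r := by
  induction r with
  | zero => simp
  | succ r ih =>
    have hd := Nat.choose_succ_right_eq d r
    have hn := Nat.choose_succ_right_eq n r
    have hstep : (d - r) * n ≤ (n - r) * d := by
      rw [Nat.sub_mul, Nat.sub_mul, mul_comm d n]
      exact Nat.sub_le_sub_left (Nat.mul_le_mul_left r h) _
    refine Nat.le_of_mul_le_mul_right ?_ (Nat.succ_pos r)
    calc d.choose (r + 1) * n ^ (r + 1) * (r + 1)
        = (d.choose (r + 1) * (r + 1)) * n ^ (r + 1) := by ring
      _ = (d.choose r * n ^ r) * ((d - r) * n) := by rw [hd]; ring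
      _ ≤ (n.choose r * d ^ r) * ((n - r) * d) := Nat.mul_le_mul ih hstep
      _ = (n.choose (r + 1) * (r + 1)) * d ^ (r + 1) := by rw [hn]; ring
      _ = n.choose (r + 1) * d ^ (r + 1) * (r + 1) := by ring

lemma choose_div_choose_le {d n r : ℕ} (h : d ≤ n) (hr : r ≤ n) :
    (d.choose r : ℝ) / n.choose r ≤ ((d : ℝ) / n) ^ r := by
  rcases Nat.eq_zero_or_pos n with rfl | hn
  · obtain rfl : r = 0 := by omega
    simp
  have hn' : (0 : ℝ) < n := by exact_mod_cast hn
  have hc : (0 : ℝ) < n.choose r := by exact_mod_cast Nat.choose_pos hr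
  rw [div_pow, div_le_div_iff₀ hc (by positivity), mul_comm ((d : ℝ) ^ r)]
  exact_mod_cast choose_mul_pow_le h r

lemma prod_le_mean_pow {ι : Type*} (S : Finset ι) (x : ι → ℝ) (hx : ∀ i ∈ S, 0 ≤ x i) :
    ∏ i ∈ S, x i ≤ ((∑ i ∈ S, x i) / S.card) ^ S.card := by
  rcases S.eq_empty_or_nonempty with rfl | hS
  · simp
  have hc : (0 : ℝ) < S.card := by exact_mod_cast Finset.card_pos.2 hS
  have h := Real.geom_mean_le_arith_mean S (fun _ => 1) x (fun _ _ => zero_le_one)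
    (by simpa using hS) hx
  simp only [Real.rpow_one, one_mul, Finset.sum_const, nsmul_eq_mul, mul_one] at h
  have hp : 0 ≤ ∏ i ∈ S, x i := Finset.prod_nonneg hx
  calc ∏ i ∈ S, x i = ((∏ i ∈ S, x i) ^ ((S.card : ℝ)⁻¹)) ^ S.card :=
        (Real.rpow_inv_natCast_pow hp (Finset.card_pos.2 hS).ne').symm
    _ ≤ _ := pow_le_pow_left₀ (Real.rpow_nonneg hp _) h _

/-- The joint choices of `v`: an `r`-element subset of the neighbours inside `T`, and a further
neighbour. -/
def localChoices {n : ℕ} (r : ℕ) (T : Finset (Vtx n)) (v : Vtx n) :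
    Finset (Σ _ : Finset (Vtx n), Vtx n) :=
  ((nbrs v ∩ T).powersetCard r).sigma fun E => nbrs v \ E

lemma card_localChoices {n : ℕ} (r : ℕ) (T : Finset (Vtx n)) (v : Vtx n) :
    (localChoices r T v).card = (degIn T v).choose r * (n - r) := by
  rw [localChoices, Finset.card_sigma, Finset.sum_const_nat (m := n - r),
    Finset.card_powersetCard, degIn]
  intro E hE
  obtain ⟨hsub, hcard⟩ := Finset.mem_powersetCard.1 hE
  rw [Finset.card_sdiff_of_subset (hsub.trans Finset.inter_subset_left), card_nbrs, hcard]

/-- Outcomes whose `(k - 1)`-out choices at `v` lie in `T v` are products of local choices. -/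
def spaceG1Equiv (n k : ℕ) (T : Vtx n → Finset (Vtx n)) :
    {ω : SpaceG1 n k // ∀ v, (ω.1.1 v : Finset (Vtx n)) ⊆ T v} ≃
      ∀ v, localChoices (k - 1) (T v) v where
  toFun ω v := ⟨⟨(ω.1.1.1 v).1, (ω.1.1.2 v).1⟩, by
    refine Finset.mem_sigma.2 ⟨Finset.mem_powersetCard.2 ⟨fun u hu => ?_, (ω.1.1.1 v).2.1⟩, ?_⟩
    · exact Finset.mem_inter.2 ⟨mem_nbrs.2 ((ω.1.1.1 v).2.2 u hu), ω.2 v hu⟩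
    · exact Finset.mem_sdiff.2 ⟨mem_nbrs.2 (ω.1.1.2 v).2, ω.1.2 v⟩⟩
  invFun g := ⟨⟨(fun v => ⟨(g v).1.1, by
      have h := Finset.mem_powersetCard.1 (Finset.mem_sigma.1 (g v).2).1
      exact ⟨h.2, fun u hu => mem_nbrs.1 (Finset.mem_inter.1 (h.1 hu)).1⟩⟩,
    fun v => ⟨(g v).1.2,
      mem_nbrs.1 (Finset.mem_sdiff.1 (Finset.mem_sigma.1 (g v).2).2).1⟩),
    fun v => (Finset.mem_sdiff.1 (Finset.mem_sigma.1 (g v).2).2).2⟩,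
    fun v u hu => (Finset.mem_inter.1
      ((Finset.mem_powersetCard.1 (Finset.mem_sigma.1 (g v).2).1).1 hu)).2⟩
  left_inv _ := rfl
  right_inv _ := rfl

lemma card_choices_subset (n k : ℕ) (T : Vtx n → Finset (Vtx n)) :
    Nat.card {ω : SpaceG1 n k // ∀ v, (ω.1.1 v : Finset (Vtx n)) ⊆ T v} =
      ∏ v, ((degIn (T v) v).choose (k - 1) * (n - (k - 1))) := by
  rw [Nat.card_congr (spaceG1Equiv n k T), Nat.card_pi]
  exact Finset.prod_congr rfl fun v _ => by
    rw [Nat.card_eq_fintype_card, Fintype.card_coe, card_localChoices]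

lemma card_spaceG1 (n k : ℕ) :
    Nat.card (SpaceG1 n k) = ∏ _v : Vtx n, (n.choose (k - 1) * (n - (k - 1))) := by
  rw [← Nat.card_congr (Equiv.subtypeUnivEquiv (p := fun ω : SpaceG1 n k =>
    ∀ v, (ω.1.1 v : Finset (Vtx n)) ⊆ Finset.univ) fun ω v => Finset.subset_univ _),
    card_choices_subset n k fun _ => Finset.univ]
  simp [degIn, card_nbrs]

lemma card_spaceG1_pos {n k : ℕ} (hkn : k - 1 < n) : 0 < Nat.card (SpaceG1 n k) := by
  rw [card_spaceG1]
  exact Finset.prod_pos fun _ _ => Nat.mul_pos (Nat.choose_pos hkn.le) (by omega)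

lemma prob_mono {Ω : Type*} [Finite Ω] {p q : Ω → Prop} (h : ∀ ω, p ω → q ω) :
    prob p ≤ prob q := by
  unfold prob
  gcongr
  exact Nat.card_le_card_of_injective (Subtype.map id h) (Subtype.map_injective h fun _ _ => id)

lemma prob_exists_le {Ω ι : Type*} [Finite Ω] (I : Finset ι) (p : ι → Ω → Prop) :
    prob (fun ω => ∃ i ∈ I, p i ω) ≤ ∑ i ∈ I, prob (p i) := by
  have := Fintype.ofFinite Ω
  unfold prob
  rw [← Finset.sum_div]
  gcongr
  simp only [Nat.card_eq_fintype_card, Fintype.card_subtype]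
  have : (Finset.univ.filter fun ω => ∃ i ∈ I, p i ω) ⊆
      I.biUnion fun i => Finset.univ.filter (p i) := by
    intro ω hω
    simpa using hω
  exact_mod_cast (Finset.card_le_card this).trans Finset.card_biUnion_le

lemma prob_not {Ω : Type*} [Finite Ω] [Nonempty Ω] (p : Ω → Prop) :
    prob (fun ω => ¬ p ω) = 1 - prob p := by
  have := Fintype.ofFinite Ω
  have h0 : (Fintype.card Ω : ℝ) ≠ 0 := by exact_mod_cast Fintype.card_ne_zero
  unfold prob
  simp only [Nat.card_eq_fintype_card, Fintype.card_subtype]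
  rw [eq_sub_iff_add_eq, ← add_div, div_eq_one_iff_eq h0, add_comm]
  exact_mod_cast Finset.card_filter_add_card_filter_not (s := Finset.univ) p

lemma prob_nonneg {Ω : Type*} [Finite Ω] (p : Ω → Prop) : 0 ≤ prob p := by
  unfold prob
  positivity

/-- The probability that all first-stage choices of `S` stay inside `T`. -/
lemma prob_choices_subset_le {n k : ℕ} (hkn : k - 1 < n) (S T : Finset (Vtx n)) (hST : S ⊆ T) :
    prob (fun ω : SpaceG1 n k => ∀ v ∈ S, (ω.1.1 v : Finset (Vtx n)) ⊆ T) ≤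
      (T.card * Real.logb 2 T.card / (S.card * n)) ^ (S.card * (k - 1)) := by
  have hn : (0 : ℝ) < n := by exact_mod_cast (Nat.zero_le _).trans_lt hkn
  set r := k - 1 with hr
  have heq : Nat.card {ω : SpaceG1 n k // ∀ v ∈ S, (ω.1.1 v : Finset (Vtx n)) ⊆ T} =
      Nat.card {ω : SpaceG1 n k // ∀ v, (ω.1.1 v : Finset (Vtx n)) ⊆
        if v ∈ S then T else Finset.univ} := by
    refine Nat.card_congr (Equiv.subtypeEquivRight fun ω => forall_congr' fun v => ?_)
    by_cases hv : v ∈ S <;> simp [hv]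
  have hnr : (0 : ℝ) < (n - r : ℕ) := by exact_mod_cast Nat.sub_pos_of_lt hkn
  have hprod : prob (fun ω : SpaceG1 n k => ∀ v ∈ S, (ω.1.1 v : Finset (Vtx n)) ⊆ T) ≤
      ∏ v ∈ S, ((degIn T v : ℝ) / n) ^ r := by
    unfold prob
    rw [heq, card_choices_subset, card_spaceG1, ← hr]
    push_cast
    rw [← Finset.prod_div_distrib, ← Finset.prod_subset (Finset.subset_univ S)]
    · refine Finset.prod_le_prod (fun v _ => by positivity) fun v hv => ?_
      rw [if_pos hv, mul_div_mul_right _ _ hnr.ne']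
      exact choose_div_choose_le (degIn_le T v) hkn.le
    · intro v _ hv
      have hc : (0 : ℝ) < n.choose r := by exact_mod_cast Nat.choose_pos hkn.le
      have hd : degIn (Finset.univ : Finset (Vtx n)) v = n := by simp [degIn, card_nbrs]
      rw [if_neg hv, hd]
      exact div_self (by positivity)
  refine hprod.trans ?_
  rw [Finset.prod_pow, pow_mul]
  refine pow_le_pow_left₀ (Finset.prod_nonneg fun _ _ => by positivity) ?_ r
  refine (prod_le_mean_pow S _ fun _ _ => by positivity).trans ?_
  refine pow_le_pow_left₀ (div_nonneg (Finset.sum_nonneg fun _ _ => by positivity)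
    (by positivity)) ?_ _
  rw [← Finset.sum_div, div_div, mul_comm (n : ℝ)]
  refine div_le_div_of_nonneg_right ?_ (by positivity)
  refine le_trans ?_ (sum_degIn_le T)
  exact_mod_cast Finset.sum_le_sum_of_subset hST

lemma graphG1_le_cubeGraph {n k : ℕ} (ω : SpaceG1 n k) : graphG1 n k ω ≤ cubeGraph n := by
  intro u v h
  rw [graphG1, SimpleGraph.fromRel_adj] at h
  rcases h.2 with (h | ⟨-, rfl⟩) | (h | ⟨-, rfl⟩)
  · exact (ω.1.1 u).2.2 v h
  · exact (ω.1.2 u).2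
  · exact ((ω.1.1 v).2.2 u h).symm
  · exact (ω.1.2 v).2.symm

lemma MinLDisc.cubeConnected {n : ℕ} {G : SimpleGraph (Vtx n)} (hG : G ≤ cubeGraph n)
    {L S : Finset (Vtx n)} (h : MinLDisc G L S) : CubeConnected S := by
  refine ⟨h.1.1, fun T hT hne => ?_⟩
  have hnot := h.2 T hT
  simp only [LDisc, not_and, not_forall] at hnot
  obtain ⟨u, hu, w, huw, hw⟩ := hnot hne (Finset.disjoint_of_subset_left hT.1 h.1.2.1)
  rw [not_or] at hw
  obtain ⟨i, rfl⟩ := (cubeGraph_adj_iff u w).1 (hG huw)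
  exact ⟨u, hu, i, Finset.mem_sdiff.2
    ⟨(h.1.2.2 u (hT.1 hu) _ huw).resolve_right hw.2, hw.1⟩⟩

/-- The vertices of `L` adjacent to `S` appear in a list of `|L|` neighbours of `S`. -/
lemma exists_neighbour_list {n r : ℕ} (hn : 0 < n) {S L : Finset (Vtx n)} (hS : S.Nonempty)
    (hL : L.card = r) :
    ∃ f : Fin r → S × Fin n, ∀ v ∈ S, ∀ u ∈ nbrs v, u ∈ L →
      u ∈ Finset.univ.image fun j => flipBit ((f j).1 : Vtx n) (f j).2 := by
  subst hL
  obtain ⟨v₀, hv₀⟩ := hS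
  have hex : ∀ u : Vtx n, ∃ p : S × Fin n, (∃ v ∈ S, u ∈ nbrs v) →
      flipBit (p.1 : Vtx n) p.2 = u := by
    intro u
    by_cases h : ∃ v ∈ S, u ∈ nbrs v
    · obtain ⟨v, hv, hu⟩ := h
      obtain ⟨i, -, rfl⟩ := Finset.mem_image.1 hu
      exact ⟨(⟨v, hv⟩, i), fun _ => rfl⟩
    · exact ⟨(⟨v₀, hv₀⟩, ⟨0, hn⟩), fun h' => absurd h' h⟩
  choose g hg using hex
  refine ⟨fun j => g (L.equivFin.symm j), fun v hv u hu huL => ?_⟩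
  refine Finset.mem_image.2 ⟨L.equivFin ⟨u, huL⟩, Finset.mem_univ _, ?_⟩
  simpa using hg u ⟨v, hv, hu⟩

/-- The bound on the expected number of pairs `(S, L)` with `|S| = s` and `|L| = r`. -/
def pairBound (n r s : ℕ) : ℝ :=
  2 ^ n * (n : ℝ) ^ (2 * s) * ((s : ℝ) * n) ^ r *
    (((s : ℝ) + r) * Real.logb 2 (s + r) / (s * n)) ^ (s * r)

lemma prob_bad_le {n k : ℕ} (hkn : k - 1 < n) (N M : ℕ) (hN : 0 < N) :
    prob (fun ω : SpaceG1 n k => ∃ S L : Finset (Vtx n), L.card = k - 1 ∧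
      MinLDisc (graphG1 n k ω) L S ∧ N ≤ S.card ∧ S.card < M) ≤
    ∑ s ∈ Finset.Ico N M, pairBound n (k - 1) s := by
  have hn : 0 < n := (Nat.zero_le _).trans_lt hkn
  set r := k - 1 with hr
  have hcover : ∀ ω : SpaceG1 n k, (∃ S L : Finset (Vtx n), L.card = r ∧
      MinLDisc (graphG1 n k ω) L S ∧ N ≤ S.card ∧ S.card < M) →
      ∃ s ∈ Finset.Ico N M, ∃ S ∈ connSets n s,
        ∃ f ∈ (Finset.univ : Finset (Fin r → S × Fin n)),
        ∀ v ∈ S, (ω.1.1 v : Finset (Vtx n)) ⊆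
          S ∪ Finset.univ.image fun j => flipBit ((f j).1 : Vtx n) (f j).2 := by
    rintro ω ⟨S, L, hL, hmin, hNS, hSM⟩
    refine ⟨S.card, Finset.mem_Ico.2 ⟨hNS, hSM⟩, S, ?_, ?_⟩
    · exact Finset.mem_filter.2
        ⟨Finset.mem_univ _, hmin.cubeConnected (graphG1_le_cubeGraph ω), rfl⟩
    · obtain ⟨f, hf⟩ := exists_neighbour_list hn hmin.1.1 hL
      refine ⟨f, Finset.mem_univ _, fun v hv u hu => Finset.mem_union.2 ?_⟩
      have hadj : (cubeGraph n).Adj v u := (ω.1.1 v).2.2 u hu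
      have hG : (graphG1 n k ω).Adj v u := by
        rw [graphG1, SimpleGraph.fromRel_adj]
        exact ⟨hadj.ne, Or.inl (Or.inl hu)⟩
      exact (hmin.1.2.2 v hv u hG).imp_right (hf v hv u (mem_nbrs.2 hadj))
  refine (prob_mono hcover).trans ?_
  refine (prob_exists_le _ _).trans (Finset.sum_le_sum fun s hs => ?_)
  have hs0 : 0 < s := hN.trans_le (Finset.mem_Ico.1 hs).1
  set P : ℝ := (((s : ℝ) + r) * Real.logb 2 (s + r) / (s * n)) ^ (s * r) with hP
  have hP0 : 0 ≤ P := by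
    have : (1 : ℝ) ≤ s + r := by exact_mod_cast (by omega : 1 ≤ s + r)
    have := Real.logb_nonneg (b := 2) (by norm_num) this
    positivity
  have hS : ∀ S ∈ connSets n s, prob (fun ω : SpaceG1 n k =>
      ∃ f ∈ (Finset.univ : Finset (Fin r → S × Fin n)),
        ∀ v ∈ S, (ω.1.1 v : Finset (Vtx n)) ⊆
          S ∪ Finset.univ.image fun j => flipBit ((f j).1 : Vtx n) (f j).2) ≤
      ((s : ℝ) * n) ^ r * P := by
    intro S hS
    have hcard : S.card = s := (Finset.mem_filter.1 hS).2.2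
    have hf : ∀ f ∈ (Finset.univ : Finset (Fin r → S × Fin n)),
        prob (fun ω : SpaceG1 n k => ∀ v ∈ S, (ω.1.1 v : Finset (Vtx n)) ⊆
          S ∪ Finset.univ.image fun j => flipBit ((f j).1 : Vtx n) (f j).2) ≤ P := by
      intro f _
      refine (prob_choices_subset_le hkn S _ Finset.subset_union_left).trans ?_
      set T := S ∪ Finset.univ.image fun j => flipBit ((f j).1 : Vtx n) (f j).2
      have hTle : (T.card : ℝ) ≤ s + r := by
        have h1 : T.card ≤ S.card + r := by
          refine (Finset.card_union_le _ _).trans (Nat.add_le_add le_rfl ?_)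
          exact Finset.card_image_le.trans (by simp)
        rw [hcard] at h1
        exact_mod_cast h1
      have hT1 : (1 : ℝ) ≤ T.card := by
        have : S.card ≤ T.card := Finset.card_le_card Finset.subset_union_left
        exact_mod_cast (by omega : 1 ≤ T.card)
      have hlog := Real.logb_nonneg (b := 2) (by norm_num) hT1
      rw [hcard, ← hr]
      refine pow_le_pow_left₀ (by positivity) ?_ _
      refine div_le_div_of_nonneg_right ?_ (by positivity)
      exact mul_le_mul hTle (Real.logb_le_logb_of_le (by norm_num) (by linarith) hTle) hlog
        (by positivity)
    refine (prob_exists_le _ _).trans ((Finset.sum_le_card_nsmul _ _ _ hf).trans ?_)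
    rw [Finset.card_univ, nsmul_eq_mul, Fintype.card_fun, Fintype.card_prod]
    simp [hcard]
  refine (prob_exists_le _ _).trans ((Finset.sum_le_card_nsmul _ _ _ hS).trans ?_)
  rw [nsmul_eq_mul, pairBound, ← hP, ← mul_assoc]
  have hc : ((connSets n s).card : ℝ) ≤ 2 ^ n * (n : ℝ) ^ (2 * s) := by
    have h1 := card_connSets_le n s
    have h2 : 2 ^ n * n ^ (2 * (s - 1)) ≤ 2 ^ n * n ^ (2 * s) :=
      Nat.mul_le_mul_left _ (Nat.pow_le_pow_right hn (by omega))
    exact_mod_cast h1.trans h2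
  gcongr

lemma pairBound_le_of_exponent {n r s : ℕ} (hn : 0 < n) (hs : 0 < s) (θ : ℝ)
    (hθ : ((s : ℝ) + r) * Real.logb 2 (s + r) / (s * n) ≤ (2 : ℝ) ^ (-θ))
    (h : (n : ℝ) + 2 * s * Real.logb 2 n + r * Real.logb 2 (s * n) + s ≤ θ * (s * r)) :
    pairBound n r s ≤ (1 / 2) ^ s := by
  have h2 : (0 : ℝ) < 2 := by norm_num
  have hn' : (0 : ℝ) < n := by exact_mod_cast hn
  have hs' : (0 : ℝ) < s := by exact_mod_cast hs
  have hlog : 0 ≤ Real.logb 2 ((s : ℝ) + r) :=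
    Real.logb_nonneg (by norm_num) (by exact_mod_cast (by omega : 1 ≤ s + r))
  have e1 : (2 : ℝ) ^ n = (2 : ℝ) ^ (n : ℝ) := (Real.rpow_natCast 2 n).symm
  have e2 : (n : ℝ) ^ (2 * s) = (2 : ℝ) ^ (2 * s * Real.logb 2 n) := by
    conv_lhs => rw [← Real.rpow_logb h2 (by norm_num) hn']
    rw [← Real.rpow_mul_natCast h2.le]
    push_cast
    ring_nf
  have e3 : ((s : ℝ) * n) ^ r = (2 : ℝ) ^ (r * Real.logb 2 (s * n)) := by
    conv_lhs => rw [← Real.rpow_logb h2 (by norm_num) (mul_pos hs' hn')]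
    rw [← Real.rpow_mul_natCast h2.le, mul_comm]
  have e4 : (((s : ℝ) + r) * Real.logb 2 (s + r) / (s * n)) ^ (s * r) ≤
      (2 : ℝ) ^ (-(θ * (s * r))) := by
    refine (pow_le_pow_left₀ (by positivity) hθ _).trans_eq ?_
    rw [← Real.rpow_mul_natCast h2.le]
    push_cast
    ring_nf
  have e5 : ((1 : ℝ) / 2) ^ s = (2 : ℝ) ^ (-(s : ℝ)) := by
    rw [Real.rpow_neg h2.le, Real.rpow_natCast, one_div, inv_pow]
  rw [pairBound, e5, e1, e2, e3]
  refine (mul_le_mul_of_nonneg_left e4 (by positivity)).trans ?_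
  rw [← Real.rpow_add h2, ← Real.rpow_add h2, ← Real.rpow_add h2]
  exact Real.rpow_le_rpow_of_exponent_le (by norm_num) (by linarith)

lemma pairBound_le_of_le_sq {n r s : ℕ} {l m : ℝ} (hl : l = Real.logb 2 n) (hm : m = Real.logb 2 l)
    (hl4 : 10000 ≤ l) (hml : m ≤ l / 1000) (hrl : l - 2 * m ≤ r) (hrn : r ≤ n)
    (hns : 1.85 * n ≤ s * l ^ 2) (hs : 300 ≤ s) (hsn : s ≤ n ^ 2) :
    pairBound n r s ≤ (1 / 2) ^ s := by
  have hl0 : 0 < l := by linarith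
  have hn : 2 ≤ n := by
    by_contra hlt
    have : n = 0 ∨ n = 1 := by omega
    rcases this with rfl | rfl <;> simp at hl <;> linarith
  have hnR : (2 : ℝ) ≤ n := by exact_mod_cast hn
  have hsR : (300 : ℝ) ≤ s := by exact_mod_cast hs
  have hsnR : (s : ℝ) ≤ (n : ℝ) ^ 2 := by exact_mod_cast hsn
  have hrnR : (r : ℝ) ≤ n := by exact_mod_cast hrn
  have h2l : (2 : ℝ) ^ l = n := by
    rw [hl, Real.rpow_logb (by norm_num) (by norm_num) (by positivity)]
  have h2m : (2 : ℝ) ^ m = l := by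
    rw [hm, Real.rpow_logb (by norm_num) (by norm_num) hl0]
  have hlog3 : Real.logb 2 ((n : ℝ) ^ 3) = 3 * l := by
    rw [Real.logb_pow, ← hl]
    norm_num
  have hlogsr : Real.logb 2 ((s : ℝ) + r) ≤ 3 * l := by
    rw [← hlog3]
    refine Real.logb_le_logb_of_le (by norm_num) (by positivity) ?_
    nlinarith
  have hlogsn : Real.logb 2 ((s : ℝ) * n) ≤ 3 * l := by
    rw [← hlog3]
    refine Real.logb_le_logb_of_le (by norm_num) (by positivity) ?_
    nlinarith
  have hrs : (r : ℝ) ≤ s * l ^ 2 := by linarith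
  have hcube : 4 * l ^ 3 ≤ (2 : ℝ) ^ (l / 100) := by
    have : 4 * l ^ 3 = (2 : ℝ) ^ (2 + m * (3 : ℕ)) := by
      rw [Real.rpow_add (by norm_num), Real.rpow_mul_natCast (by norm_num), h2m]
      norm_num
    rw [this]
    refine Real.rpow_le_rpow_of_exponent_le (by norm_num) ?_
    push_cast
    linarith
  refine pairBound_le_of_exponent (by omega) (by omega) (99 / 100 * l) ?_ ?_
  · have e : (2 : ℝ) ^ (-(99 / 100 * l)) = (2 : ℝ) ^ (l / 100) / n := by
      rw [← h2l, ← Real.rpow_sub (by norm_num)]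
      ring_nf
    rw [e, div_le_div_iff₀ (by positivity) (by positivity)]
    have h1 : ((s : ℝ) + r) * Real.logb 2 (s + r) ≤ (s + s * l ^ 2) * (3 * l) :=
      mul_le_mul (by linarith) hlogsr
        (Real.logb_nonneg (by norm_num) (by linarith [Nat.cast_nonneg (α := ℝ) r]))
        (by positivity)
    have h2 : ((s : ℝ) + s * l ^ 2) * (3 * l) ≤ 4 * l ^ 3 * s := by
      have : 3 * l ≤ l ^ 3 := by nlinarith
      nlinarith
    calc ((s : ℝ) + r) * Real.logb 2 (s + r) * n ≤ 4 * l ^ 3 * s * n := by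
          exact mul_le_mul_of_nonneg_right (h1.trans h2) (by positivity)
      _ ≤ (2 : ℝ) ^ (l / 100) * s * n := by gcongr
      _ = _ := by ring
  · rw [← hl]
    have hr : 998 / 1000 * l ≤ r := by linarith
    have hr0 : (0 : ℝ) ≤ r := Nat.cast_nonneg r
    have a1 : (r : ℝ) * Real.logb 2 (s * n) ≤ 1 / 100 * (s * r * l) := by
      calc (r : ℝ) * Real.logb 2 (s * n) ≤ r * (3 * l) := by gcongr
        _ = 1 / 100 * (300 * (r * l)) := by ring
        _ ≤ 1 / 100 * (s * (r * l)) := by gcongr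
        _ = _ := by ring
    have a2 : 998 / 1000 * (s * l ^ 2) ≤ s * r * l := by
      calc 998 / 1000 * (s * l ^ 2) = s * (998 / 1000 * l) * l := by ring
        _ ≤ _ := by gcongr
    have a3 : 10000 * (s * l) ≤ s * l ^ 2 := by
      calc 10000 * (s * l) = s * (10000 * l) := by ring
        _ ≤ s * (l * l) := by gcongr
        _ = _ := by ring
    have a4 : (s : ℝ) ≤ s * l := le_mul_of_one_le_right (by linarith) (by linarith)
    have a5 : 99 / 100 * l * (s * r) = 99 / 100 * (s * r * l) := by ring
    rw [a5]
    linarith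

lemma pairBound_le_of_sq_le {n r s : ℕ} {l m : ℝ} (hl : l = Real.logb 2 n) (hl4 : 10000 ≤ l)
    (hml : m ≤ l / 1000) (hrl : l - 2 * m ≤ r) (hrn : r ≤ n) (hn : 10000 ≤ n)
    (hsn : n ^ 2 ≤ s) (hlogs : Real.logb 2 s ≤ s / 200)
    (hs5 : (s : ℝ) ≤ (2 : ℝ) ^ ((n : ℝ) / 5)) :
    pairBound n r s ≤ (1 / 2) ^ s := by
  have hnR : (10000 : ℝ) ≤ n := by exact_mod_cast hn
  have hsnR : (n : ℝ) ^ 2 ≤ s := by exact_mod_cast hsn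
  have hrnR : (r : ℝ) ≤ n := by exact_mod_cast hrn
  have hns : (n : ℝ) ≤ s := by nlinarith
  have hs0 : (0 : ℝ) < s := by linarith
  have hr0 : (0 : ℝ) ≤ r := Nat.cast_nonneg r
  have hls : Real.logb 2 s ≤ n / 5 := by
    rwa [Real.logb_le_iff_le_rpow (by norm_num) hs0]
  have hlogsr : Real.logb 2 ((s : ℝ) + r) ≤ n / 5 + 1 := by
    calc Real.logb 2 ((s : ℝ) + r) ≤ Real.logb 2 (s * 2) :=
          Real.logb_le_logb_of_le (by norm_num) (by linarith) (by linarith)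
      _ = Real.logb 2 s + 1 := by
          rw [Real.logb_mul hs0.ne' (by norm_num), Real.logb_self_eq_one (by norm_num)]
      _ ≤ _ := by linarith
  have hlogsn : Real.logb 2 ((s : ℝ) * n) ≤ s / 100 := by
    rw [Real.logb_mul hs0.ne' (by linarith)]
    have := Real.logb_le_logb_of_le (b := 2) (by norm_num) (by linarith) hns
    linarith
  refine pairBound_le_of_exponent (by omega) (by exact_mod_cast hs0) (21 / 10) ?_ ?_
  · have hpow : (10 / 44 : ℝ) ≤ (2 : ℝ) ^ (-(21 / 10) : ℝ) := by
      have h44 : (2 : ℝ) ^ (21 / 10 : ℝ) ≤ 44 / 10 := by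
        refine le_of_pow_le_pow_left₀ (n := 10) (by norm_num) (by norm_num) ?_
        rw [← Real.rpow_mul_natCast (by norm_num)]
        norm_num
      rw [Real.rpow_neg (by norm_num), ← one_div, div_le_div_iff₀ (by norm_num) (by positivity)]
      linarith
    refine le_trans ?_ hpow
    rw [div_le_iff₀ (by positivity)]
    have h1 : ((s : ℝ) + r) * Real.logb 2 (s + r) ≤ (s + n) * (n / 5 + 1) :=
      mul_le_mul (by linarith) hlogsr (Real.logb_nonneg (by norm_num) (by linarith))
        (by positivity)
    have h2 : 10000 * (s : ℝ) ≤ s * n := by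
      rw [mul_comm]
      gcongr
    nlinarith
  · rw [← hl]
    have hr : 998 / 1000 * l ≤ r := by linarith
    have a1 : (r : ℝ) * Real.logb 2 (s * n) ≤ 1 / 100 * (s * r) := by
      calc (r : ℝ) * Real.logb 2 (s * n) ≤ r * (s / 100) := by gcongr
        _ = _ := by ring
    have a2 : 998 / 1000 * (s * l) ≤ s * r := by
      calc 998 / 1000 * (s * l) = s * (998 / 1000 * l) := by ring
        _ ≤ _ := by gcongr
    have a3 : 10000 * (s : ℝ) ≤ s * l := by
      rw [mul_comm]
      gcongr
    linarith

lemma mul_le_nsmall_mul_sq {n : ℕ} {l : ℝ} (hl : l = Real.logb 2 n) (hl0 : 1 ≤ l) :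
    1.85 * n ≤ nsmall n * l ^ 2 := by
  have hn : (0 : ℝ) < n := by
    rcases Nat.eq_zero_or_pos n with rfl | h
    · simp at hl
      linarith
    · exact_mod_cast h
  have h2l : (2 : ℝ) ^ l = n := by
    rw [hl, Real.rpow_logb (by norm_num) (by norm_num) hn]
  have hsq : (2 : ℝ) ^ (2 * Real.logb 2 l) = l ^ 2 := by
    rw [mul_comm, ← Nat.cast_ofNat (R := ℝ) (n := 2), Real.rpow_mul_natCast (by norm_num)]
    push_cast
    rw [Real.rpow_logb (by norm_num) (by norm_num) (by linarith)]
  have hk : l - 2 * Real.logb 2 l + 0.9 ≤ (kone n : ℝ) - 0.1 := by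
    have := Int.le_ceil (Real.logb 2 n - 2 * Real.logb 2 (Real.logb 2 n))
    rw [kone, hl]
    push_cast
    linarith
  have h185 : (1.85 : ℝ) ≤ (2 : ℝ) ^ (0.9 : ℝ) := by
    refine le_of_pow_le_pow_left₀ (n := 10) (by norm_num) (by positivity) ?_
    rw [← Real.rpow_mul_natCast (by norm_num)]
    norm_num
  calc 1.85 * (n : ℝ) ≤ (2 : ℝ) ^ (0.9 : ℝ) * n := by gcongr
    _ = (2 : ℝ) ^ (l - 2 * Real.logb 2 l + 0.9) * l ^ 2 := by
        rw [← h2l, ← hsq, ← Real.rpow_add (by norm_num), ← Real.rpow_add (by norm_num)]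
        ring_nf
    _ ≤ nsmall n * l ^ 2 := by
        rw [nsmall]
        gcongr
        norm_num

lemma eventually_logb_le (c : ℝ) (hc : 0 < c) : ∀ᶠ x : ℝ in atTop, Real.logb 2 x ≤ c * x := by
  have h2 : (0 : ℝ) < Real.log 2 := Real.log_pos (by norm_num)
  have h := Real.isLittleO_log_id_atTop.bound (mul_pos hc h2)
  filter_upwards [h, eventually_ge_atTop 1] with x hx hx1
  rw [id, Real.norm_of_nonneg (Real.log_nonneg hx1), Real.norm_of_nonneg (by linarith)] at hx
  rw [Real.logb, div_le_iff₀ h2]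
  linarith

lemma tendsto_logb_natCast : Tendsto (fun n : ℕ => Real.logb 2 n) atTop atTop :=
  (Real.tendsto_logb_atTop (by norm_num)).comp tendsto_natCast_atTop_atTop

lemma eventually_const_mul_logb_sq_le (c : ℝ) :
    ∀ᶠ n : ℕ in atTop, c * Real.logb 2 n ^ 2 ≤ n := by
  have h2 : (0 : ℝ) < Real.log 2 := Real.log_pos (by norm_num)
  have h := (Real.isLittleO_pow_log_id_atTop (n := 2)).bound
    (show (0 : ℝ) < Real.log 2 ^ 2 / (|c| + 1) by positivity)
  filter_upwards [tendsto_natCast_atTop_atTop.eventually h] with n hn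
  rw [id, Real.norm_of_nonneg (by positivity), Real.norm_of_nonneg (by positivity)] at hn
  have hc : c ≤ |c| + 1 := by linarith [le_abs_self c]
  calc c * Real.logb 2 n ^ 2 ≤ (|c| + 1) * Real.logb 2 n ^ 2 := by gcongr
    _ = (|c| + 1) * Real.log n ^ 2 / Real.log 2 ^ 2 := by
        rw [Real.logb]
        ring
    _ ≤ (|c| + 1) * (Real.log 2 ^ 2 / (|c| + 1) * n) / Real.log 2 ^ 2 := by gcongr
    _ = n := by field_simp

lemma tendsto_nsmall : Tendsto nsmall atTop atTop := by
  refine tendsto_atTop.2 fun C => ?_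
  filter_upwards [eventually_const_mul_logb_sq_le C, tendsto_logb_natCast.eventually_ge_atTop 1]
    with n hn hl
  have h := mul_le_nsmall_mul_sq rfl hl
  have hn0 : (0 : ℝ) ≤ n := Nat.cast_nonneg n
  exact le_of_mul_le_mul_right (by linarith) (by positivity : 0 < Real.logb 2 (n : ℝ) ^ 2)

lemma eventually_pairBound_le : ∀ᶠ n : ℕ in atTop, ∀ r s : ℕ,
    Real.logb 2 n - 2 * Real.logb 2 (Real.logb 2 n) ≤ r → r ≤ n → nsmall n ≤ s →
    (s : ℝ) ≤ (2 : ℝ) ^ ((n : ℝ) / 5) → pairBound n r s ≤ (1 / 2) ^ s := by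
  obtain ⟨X, hX⟩ := eventually_atTop.1 (eventually_logb_le (1 / 200) (by norm_num))
  filter_upwards [tendsto_logb_natCast.eventually_ge_atTop 10000,
    tendsto_logb_natCast.eventually (eventually_logb_le (1 / 1000) (by norm_num)),
    eventually_ge_atTop 10000, tendsto_natCast_atTop_atTop.eventually_ge_atTop X,
    tendsto_nsmall.eventually_ge_atTop 300] with n hl hm hn hnX h300 r s hr hrn hs hs5
  rcases le_total s (n ^ 2) with h | h
  · refine pairBound_le_of_le_sq rfl rfl hl (by linarith) hr hrn ?_
      (by exact_mod_cast h300.trans hs) h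
    exact (mul_le_nsmall_mul_sq rfl (by linarith)).trans (by gcongr)
  · have hsX : X ≤ s := by
      have : n ≤ s := (Nat.le_self_pow (by norm_num) n).trans h
      exact hnX.trans (by exact_mod_cast this)
    have := hX s hsX
    exact pairBound_le_of_sq_le rfl hl (by linarith) hr hrn hn h (by linarith) hs5

/-- Staged construction, medium sets: if `k₁ ≤ k(n) ≤ n−1` (for all large `n`), then
w.h.p. there are no sets `S, L ⊆ V` with `|L| = k−1`, `S` a minimal `L`-disconnected
set of `G₁`, and `n_s ≤ |S| ≤ 2^{n/5}`. -/
theorem stmt_17 (k : ℕ → ℕ)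
    (hk : ∀ᶠ n : ℕ in atTop, kone n ≤ (k n : ℤ) ∧ k n ≤ n - 1) :
    Tendsto (fun n : ℕ =>
        prob (fun ω : SpaceG1 n (k n) =>
          ¬ ∃ S L : Finset (Vtx n), L.card = k n - 1 ∧
              MinLDisc (graphG1 n (k n) ω) L S ∧
              nsmall n ≤ (S.card : ℝ) ∧ (S.card : ℝ) ≤ (2 : ℝ) ^ ((n : ℝ) / 5)))
      atTop (nhds 1) := by

  set bad : ∀ n, SpaceG1 n (k n) → Prop := fun n ω =>
    ∃ S L : Finset (Vtx n), L.card = k n - 1 ∧ MinLDisc (graphG1 n (k n) ω) L S ∧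
      nsmall n ≤ (S.card : ℝ) ∧ (S.card : ℝ) ≤ (2 : ℝ) ^ ((n : ℝ) / 5)
  have hlim : Tendsto (fun n : ℕ => 1 - (1 / 2 : ℝ) ^ ⌈nsmall n⌉₊ / (1 - 1 / 2))
      atTop (nhds 1) := by
    have h := ((tendsto_pow_atTop_nhds_zero_of_lt_one (r := (1 / 2 : ℝ)) (by norm_num)
      (by norm_num)).comp (tendsto_nat_ceil_atTop.comp tendsto_nsmall)).div_const (1 - 1 / 2)
    simpa using h.const_sub 1
  have hprob : ∀ᶠ n : ℕ in atTop, prob (fun ω => ¬ bad n ω) = 1 - prob (bad n) ∧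
      prob (bad n) ≤ (1 / 2 : ℝ) ^ ⌈nsmall n⌉₊ / (1 - 1 / 2) := by
    filter_upwards [hk, eventually_pairBound_le, eventually_ge_atTop 1] with n hkn hpair hn
    have hr : k n - 1 < n := by omega
    have hne : Nonempty (SpaceG1 n (k n)) := (Nat.card_pos_iff.1 (card_spaceG1_pos hr)).1
    refine ⟨prob_not _, ?_⟩
    set N := ⌈nsmall n⌉₊
    set M := ⌊(2 : ℝ) ^ ((n : ℝ) / 5)⌋₊ + 1
    have hN : 0 < N := Nat.ceil_pos.2 (Real.rpow_pos_of_pos (by norm_num) _)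
    have hsub : ∀ ω, bad n ω → ∃ S L : Finset (Vtx n), L.card = k n - 1 ∧
        MinLDisc (graphG1 n (k n) ω) L S ∧ N ≤ S.card ∧ S.card < M := by
      rintro ω ⟨S, L, hL, hmin, h1, h2⟩
      exact ⟨S, L, hL, hmin, Nat.ceil_le.2 h1, Nat.lt_succ_of_le (Nat.le_floor h2)⟩
    have hkr : Real.logb 2 n - 2 * Real.logb 2 (Real.logb 2 n) ≤ ((k n - 1 : ℕ) : ℝ) := by
      have h1 := Int.le_ceil (Real.logb 2 n - 2 * Real.logb 2 (Real.logb 2 n))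
      have h2 : ⌈Real.logb 2 n - 2 * Real.logb 2 (Real.logb 2 n)⌉ ≤ ((k n - 1 : ℕ) : ℤ) := by
        have := hkn.1
        rw [kone] at this
        omega
      exact h1.trans (by exact_mod_cast h2)
    calc prob (bad n) ≤ _ := prob_mono hsub
      _ ≤ ∑ s ∈ Finset.Ico N M, pairBound n (k n - 1) s := prob_bad_le hr N M hN
      _ ≤ ∑ s ∈ Finset.Ico N M, (1 / 2 : ℝ) ^ s := Finset.sum_le_sum fun s hs => by
          obtain ⟨hs1, hs2⟩ := Finset.mem_Ico.1 hs
          exact hpair _ s hkr hr.le (Nat.ceil_le.1 hs1)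
            ((Nat.le_floor_iff (by positivity)).1 (Nat.le_of_lt_succ hs2))
      _ ≤ _ := geom_sum_Ico_le_of_lt_one (by norm_num) (by norm_num)
  refine tendsto_of_tendsto_of_tendsto_of_le_of_le' hlim tendsto_const_nhds ?_ ?_
  · filter_upwards [hprob] with n h
    rw [h.1]
    linarith [h.2]
  · filter_upwards [hprob] with n h
    rw [h.1]
    linarith [prob_nonneg (bad n)]
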